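/- Let s, t be real numbers with s ≠ t, let α = min{s, t}, and define Φ_{s,t}(x) = [(ψ(x+s) − ψ(x+t))/(s − t)] · [Γ(x+s)/Γ(x+t)]^{1/(s−t)} on (−α, ∞). Then Φ_{s,t} is increasing on (−α, ∞) if |t − s| < 1 and decreasing on (−α, ∞) if |t − s| > 1. Consequently, for 0 < |t − s| < 1 the inequality [Γ(x+t)/Γ(x+s)]^{1/(t−s)} < (t − s)/(ψ(x+t) − ψ(x+s)) holds for all x ∈ (−α, ∞), and the reversed inequality holds when |t − s| > 1. -/

import Mathlib

/-- The digamma function `ψ = Γ'/Γ`, as the derivative of `log ∘ Γ`. -/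
noncomputable def digamma (x : ℝ) : ℝ := deriv (fun y : ℝ => Real.log (Real.Gamma y)) x

section

open Real Set Filter Topology

lemma hasDerivAt_log_Gamma {y : ℝ} (hy : 0 < y) :
    HasDerivAt (fun x : ℝ => log (Gamma x)) (digamma y) y := by
  have h : DifferentiableAt ℝ Gamma y :=
    Real.differentiableAt_Gamma fun m => by
      have : (0 : ℝ) ≤ m := Nat.cast_nonneg m
      linarith
  exact (h.log (Gamma_pos_of_pos hy).ne').hasDerivAt

lemma log_Gamma_add_one {y : ℝ} (hy : 0 < y) :
    log (Gamma (y + 1)) = log y + log (Gamma y) := by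
  rw [Gamma_add_one hy.ne', log_mul hy.ne' (Gamma_pos_of_pos hy).ne']

lemma digamma_add_one {y : ℝ} (hy : 0 < y) : digamma (y + 1) = digamma y + 1 / y := by
  have h₁ : HasDerivAt (fun x : ℝ => log (Gamma (x + 1))) (digamma (y + 1)) y :=
    (hasDerivAt_log_Gamma (by linarith : 0 < y + 1)).comp_add_const y 1
  have h₂ : HasDerivAt (fun x : ℝ => log x + log (Gamma x)) (y⁻¹ + digamma y) y :=
    (hasDerivAt_log hy.ne').add (hasDerivAt_log_Gamma hy)
  have h₃ : (fun x : ℝ => log (Gamma (x + 1))) =ᶠ[𝓝 y] fun x => log x + log (Gamma x) := by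
    filter_upwards [Ioi_mem_nhds hy] with x hx using log_Gamma_add_one hx
  rw [h₁.unique (h₂.congr_of_eventuallyEq h₃), one_div, add_comm]

lemma monotoneOn_digamma : MonotoneOn digamma (Ioi 0) :=
  convexOn_log_Gamma.monotoneOn_deriv fun _ hx => (hasDerivAt_log_Gamma hx).differentiableAt

lemma digamma_add_nat_le {y : ℝ} (hy : 0 < y) (n : ℕ) :
    digamma (y + n) ≤ digamma y + n / y := by
  induction n with
  | zero => simp
  | succ n ih =>
    have hn : (0 : ℝ) ≤ n := Nat.cast_nonneg n
    have h : 1 / (y + n) ≤ 1 / y := one_div_le_one_div_of_le hy (by linarith)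
    push_cast
    rw [← add_assoc, digamma_add_one (by linarith), add_div]
    linarith

lemma tendsto_digamma_add_sub (d : ℝ) (hd : 0 < d) :
    Tendsto (fun y => digamma (y + d) - digamma y) atTop (𝓝 0) := by
  obtain ⟨n, hn⟩ := exists_nat_gt d
  refine squeeze_zero' (g := fun y : ℝ => n / y) ?_ ?_ (tendsto_const_nhds.div_atTop tendsto_id)
  · filter_upwards [eventually_gt_atTop 0] with y hy
    exact sub_nonneg.2 (monotoneOn_digamma hy (by simp; linarith) (by linarith))
  · filter_upwards [eventually_gt_atTop 0] with y hy
    have h₁ : digamma (y + d) ≤ digamma (y + n) :=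
      monotoneOn_digamma (by simp; linarith) (by simp; linarith) (by linarith)
    linarith [digamma_add_nat_le hy n]

lemma tendsto_add_natCast (y : ℝ) : Tendsto (fun n : ℕ => y + n) atTop atTop :=
  tendsto_atTop_add_const_left _ _ tendsto_natCast_atTop_atTop

/-- A function that strictly decreases under unit shifts and vanishes at infinity is positive. -/
lemma pos_of_add_one_lt_of_tendsto {f : ℝ → ℝ} (hf : ∀ y, 0 < y → f (y + 1) < f y)
    (hlim : ∀ y, 0 < y → Tendsto (fun n : ℕ => f (y + n)) atTop (𝓝 0)) {y : ℝ} (hy : 0 < y) :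
    0 < f y := by
  have h : Antitone fun n : ℕ => f (y + 1 + n) := antitone_nat_of_succ_le fun n => by
    have hn : (0 : ℝ) ≤ n := Nat.cast_nonneg n
    push_cast
    rw [← add_assoc]
    exact (hf _ (by linarith)).le
  have h₀ := h.le_of_tendsto (hlim (y + 1) (by linarith)) 0
  simp only [Nat.cast_zero, add_zero] at h₀
  exact h₀.trans_lt (hf y hy)

lemma digamma_add_sub_add_one {d y : ℝ} (hd : 0 < d) (hy : 0 < y) :
    digamma (y + 1 + d) - digamma (y + 1) =
      digamma (y + d) - digamma y - (1 / y - 1 / (y + d)) := by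
  rw [add_right_comm, digamma_add_one hy, digamma_add_one (by linarith)]
  ring

lemma div_add_lt_digamma_add_sub {d y : ℝ} (hd : 0 < d) (hy : 0 < y) :
    d / (y + d) < digamma (y + d) - digamma y := by
  suffices 0 < digamma (y + d) - digamma y - d / (y + d) by linarith
  refine pos_of_add_one_lt_of_tendsto
    (f := fun y => digamma (y + d) - digamma y - d / (y + d)) (fun y hy => ?_) (fun y _ => ?_) hy
  · simp only [digamma_add_sub_add_one hd hy]
    rw [← sub_pos]
    have : digamma (y + d) - digamma y - d / (y + d) -
        (digamma (y + d) - digamma y - (1 / y - 1 / (y + d)) - d / (y + 1 + d)) =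
        d * (d + 1) / (y * (y + d) * (y + 1 + d)) := by
      field_simp
      ring
    rw [this]
    positivity
  · have h := (tendsto_digamma_add_sub d hd).sub
      ((tendsto_const_nhds (x := d)).div_atTop (tendsto_atTop_add_const_right atTop d tendsto_id))
    rw [sub_zero] at h
    exact h.comp (tendsto_add_natCast y)

lemma digamma_add_sub_pos {d y : ℝ} (hd : 0 < d) (hy : 0 < y) :
    0 < digamma (y + d) - digamma y :=
  lt_trans (by positivity) (div_add_lt_digamma_add_sub hd hy)

lemma digamma_add_sub_lt_div {d y : ℝ} (hd : 0 < d) (hy : 0 < y) :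
    digamma (y + 1 + d) - digamma (y + 1) < d / y := by
  suffices 0 < d / y - (digamma (y + 1 + d) - digamma (y + 1)) by linarith
  refine pos_of_add_one_lt_of_tendsto
    (f := fun y => d / y - (digamma (y + 1 + d) - digamma (y + 1)))
    (fun y hy => ?_) (fun y _ => ?_) hy
  · simp only [digamma_add_sub_add_one hd (by linarith : 0 < y + 1)]
    rw [← sub_pos]
    have : d / y - (digamma (y + 1 + d) - digamma (y + 1)) -
        (d / (y + 1) - (digamma (y + 1 + d) - digamma (y + 1) -
          (1 / (y + 1) - 1 / (y + 1 + d)))) =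
        d * (d + 1) / (y * (y + 1) * (y + 1 + d)) := by
      field_simp
      ring
    rw [this]
    positivity
  · have h := ((tendsto_const_nhds (x := d)).div_atTop tendsto_id).sub
      ((tendsto_digamma_add_sub d hd).comp (tendsto_atTop_add_const_right atTop 1 tendsto_id))
    rw [sub_zero] at h
    exact h.comp (tendsto_add_natCast y)

lemma hasSum_digamma_add_sub {d y : ℝ} (hd : 0 < d) (hy : 0 < y) :
    HasSum (fun n : ℕ => 1 / (y + n) - 1 / (y + n + d)) (digamma (y + d) - digamma y) := by
  have hpos (n : ℕ) : 0 < y + n := by positivity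
  rw [hasSum_iff_tendsto_nat_of_nonneg fun n =>
    sub_nonneg.2 (one_div_le_one_div_of_le (hpos n) (by linarith))]
  have hsum (n : ℕ) : ∑ k ∈ Finset.range n, (1 / (y + k) - 1 / (y + k + d)) =
      digamma (y + d) - digamma y - (digamma (y + n + d) - digamma (y + n)) := by
    induction n with
    | zero => simp
    | succ n ih =>
      rw [Finset.sum_range_succ, ih]
      push_cast
      rw [← add_assoc y, digamma_add_sub_add_one hd (hpos n)]
      ring
  simp_rw [hsum]
  simpa using tendsto_const_nhds.sub
    ((tendsto_digamma_add_sub d hd).comp (tendsto_add_natCast y))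

/-- The derivative in `y` of `digamma (y + d) - digamma y`, as a series. -/
noncomputable def digammaGapDeriv (d y : ℝ) : ℝ :=
  ∑' n : ℕ, (1 / (y + n + d) ^ 2 - 1 / (y + n) ^ 2)

lemma norm_one_div_sq_sub_le {d δ y : ℝ} (hd : 0 < d) (hδ : 0 < δ) (hy : δ ≤ y) (n : ℕ) :
    ‖1 / (y + n + d) ^ 2 - 1 / (y + n) ^ 2‖ ≤ 1 / |(n : ℝ) + δ| ^ (2 : ℝ) := by
  have hn : (0 : ℝ) ≤ n := Nat.cast_nonneg n
  have hy₀ : 0 < y + n := by linarith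
  rw [abs_of_pos (by linarith), rpow_two, norm_sub_rev, norm_eq_abs, abs_of_nonneg]
  · have : 1 / (y + n) ^ 2 ≤ 1 / (n + δ) ^ 2 := by
      gcongr 1 / ?_ ^ 2
      linarith
    have : 0 ≤ 1 / (y + n + d) ^ 2 := by positivity
    linarith
  · rw [sub_nonneg]
    gcongr 1 / ?_ ^ 2
    linarith

lemma summable_one_div_abs_sq (δ : ℝ) :
    Summable fun n : ℕ => 1 / |(n : ℝ) + δ| ^ (2 : ℝ) :=
  (summable_one_div_nat_add_rpow δ 2).2 one_lt_two

lemma summable_digammaGapDeriv {d y : ℝ} (hd : 0 < d) (hy : 0 < y) :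
    Summable fun n : ℕ => 1 / (y + n + d) ^ 2 - 1 / (y + n) ^ 2 :=
  .of_norm_bounded (summable_one_div_abs_sq y) (norm_one_div_sq_sub_le hd hy le_rfl)

lemma hasDerivAt_digamma_add_sub {d y : ℝ} (hd : 0 < d) (hy : 0 < y) :
    HasDerivAt (fun x => digamma (x + d) - digamma x) (digammaGapDeriv d y) y := by
  have hδ : 0 < y / 2 := half_pos hy
  have hmem : y ∈ Ioi (y / 2) := half_lt_self hy
  have h : HasDerivAt (fun x => ∑' n : ℕ, (1 / (x + n) - 1 / (x + n + d)))
      (digammaGapDeriv d y) y := by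
    refine hasDerivAt_tsum_of_isPreconnected (summable_one_div_abs_sq (y / 2)) isOpen_Ioi
      isPreconnected_Ioi (fun n x hx => ?_)
      (fun n x hx => norm_one_div_sq_sub_le hd hδ (le_of_lt (mem_Ioi.1 hx)) n) hmem
      (hasSum_digamma_add_sub hd hy).summable hmem
    have hn : (0 : ℝ) ≤ n := Nat.cast_nonneg n
    have hx₀ : 0 < x + n := by
      have : y / 2 < x := hx
      linarith
    have h₁ := ((hasDerivAt_id x).add_const (n : ℝ)).fun_inv hx₀.ne'
    have h₂ := (((hasDerivAt_id x).add_const (n : ℝ)).add_const d).fun_inv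
      (by simp only [id]; linarith)
    convert! h₁.sub h₂ using 1
    · ext z
      simp
    · simp only [id]
      ring
  refine h.congr_of_eventuallyEq ?_
  filter_upwards [Ioi_mem_nhds hy] with x hx using (hasSum_digamma_add_sub hd hx).tsum_eq.symm

lemma digammaGapDeriv_add_one {d y : ℝ} (hd : 0 < d) (hy : 0 < y) :
    digammaGapDeriv d (y + 1) = digammaGapDeriv d y - (1 / (y + d) ^ 2 - 1 / y ^ 2) := by
  have h : digammaGapDeriv d y = _ := (summable_digammaGapDeriv hd hy).tsum_eq_zero_add
  rw [h, digammaGapDeriv]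
  simp only [Nat.cast_zero, add_zero, Nat.cast_add, Nat.cast_one, add_sub_cancel_left,
    add_comm, add_left_comm]

lemma tendsto_digammaGapDeriv (d y : ℝ) :
    Tendsto (fun n : ℕ => digammaGapDeriv d (y + n)) atTop (𝓝 0) := by
  convert! tendsto_sum_nat_add fun n : ℕ => 1 / (y + n + d) ^ 2 - 1 / (y + n) ^ 2 using 2 with n
  rw [digammaGapDeriv]
  simp only [Nat.cast_add, add_assoc, add_comm]

lemma one_sub_mul_two_mul_digamma_gap_pos {d y : ℝ} (hd : 0 < d) (hd₁ : d ≠ 1) (hy : 0 < y) :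
    0 < (1 - d) * (2 * (digamma (y + d) - digamma y) - (1 / y - 1 / (y + d)) -
      d * (1 / y + 1 / (y + d))) := by
  refine pos_of_add_one_lt_of_tendsto
    (f := fun y => (1 - d) * (2 * (digamma (y + d) - digamma y) - (1 / y - 1 / (y + d)) -
      d * (1 / y + 1 / (y + d)))) (fun y hy => ?_) (fun y _ => ?_) hy
  · simp only [digamma_add_sub_add_one hd hy]
    rw [← sub_pos, ← mul_sub]
    have hd₂ : 1 - d ≠ 0 := sub_ne_zero.2 hd₁.symm
    have : (2 * (digamma (y + d) - digamma y) - (1 / y - 1 / (y + d)) -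
        d * (1 / y + 1 / (y + d))) -
        (2 * (digamma (y + d) - digamma y - (1 / y - 1 / (y + d))) -
          (1 / (y + 1) - 1 / (y + 1 + d)) - d * (1 / (y + 1) + 1 / (y + 1 + d))) =
        (1 - d) * (d * (d + 1) / (y * (y + 1) * (y + d) * (y + 1 + d))) := by
      field_simp
      ring
    rw [this, ← mul_assoc]
    have : 0 < (1 - d) * (1 - d) := mul_self_pos.2 hd₂
    positivity
  · have h₁ : Tendsto (fun y : ℝ => 1 / y) atTop (𝓝 0) :=
      tendsto_const_nhds.div_atTop tendsto_id
    have h₂ : Tendsto (fun y : ℝ => 1 / (y + d)) atTop (𝓝 0) :=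
      tendsto_const_nhds.div_atTop (tendsto_atTop_add_const_right atTop d tendsto_id)
    have h := ((((tendsto_digamma_add_sub d hd).const_mul 2).sub (h₁.sub h₂)).sub
      ((h₁.add h₂).const_mul d)).const_mul (1 - d)
    simp only [mul_zero, sub_zero, add_zero] at h
    exact h.comp (tendsto_add_natCast y)

lemma one_sub_mul_sq_add_digammaGapDeriv_pos {d y : ℝ} (hd : 0 < d) (hd₁ : d ≠ 1) (hy : 0 < y) :
    0 < (1 - d) * ((digamma (y + d) - digamma y) ^ 2 + d * digammaGapDeriv d y) := by
  refine pos_of_add_one_lt_of_tendsto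
    (f := fun y => (1 - d) * ((digamma (y + d) - digamma y) ^ 2 + d * digammaGapDeriv d y))
    (fun y hy => ?_) (fun y _ => ?_) hy
  · simp only [digamma_add_sub_add_one hd hy, digammaGapDeriv_add_one hd hy]
    rw [← sub_pos]
    have hc : 0 < 1 / y - 1 / (y + d) :=
      sub_pos.2 (one_div_lt_one_div_of_lt hy (by linarith))
    have h := mul_pos hc (one_sub_mul_two_mul_digamma_gap_pos hd hd₁ hy)
    refine h.trans_eq ?_
    simp only [one_div, ← inv_pow]
    ring
  · have h := ((((tendsto_digamma_add_sub d hd).comp (tendsto_add_natCast y)).pow 2).add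
      ((tendsto_digammaGapDeriv d y).const_mul d)).const_mul (1 - d)
    simpa using h

/-- The logarithm of `Φ_{d,0}`. -/
noncomputable def logPhi (d y : ℝ) : ℝ :=
  log ((digamma (y + d) - digamma y) / d) + (log (Gamma (y + d)) - log (Gamma y)) / d

lemma hasDerivAt_logPhi {d y : ℝ} (hd : 0 < d) (hy : 0 < y) :
    HasDerivAt (logPhi d) (((digamma (y + d) - digamma y) ^ 2 + d * digammaGapDeriv d y) /
      (d * (digamma (y + d) - digamma y))) y := by
  have hA := digamma_add_sub_pos hd hy
  have h₁ := ((hasDerivAt_digamma_add_sub hd hy).div_const d).log (div_pos hA hd).ne'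
  have h₂ := (((hasDerivAt_log_Gamma (by linarith : 0 < y + d)).comp_add_const y d).sub
    (hasDerivAt_log_Gamma hy)).div_const d
  convert! h₁.add h₂ using 1
  field_simp
  ring

lemma strictMonoOn_one_sub_mul_logPhi {d : ℝ} (hd : 0 < d) (hd₁ : d ≠ 1) :
    StrictMonoOn (fun y => (1 - d) * logPhi d y) (Ioi 0) := by
  have h (y : ℝ) (hy : 0 < y) := (hasDerivAt_logPhi hd hy).const_mul (1 - d)
  refine strictMonoOn_of_deriv_pos (convex_Ioi 0)
    (fun y hy => (h y hy).continuousAt.continuousWithinAt) fun y hy => ?_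
  rw [interior_Ioi] at hy
  rw [(h y hy).deriv, ← mul_div_assoc]
  exact div_pos (one_sub_mul_sq_add_digammaGapDeriv_pos hd hd₁ hy)
    (mul_pos hd (digamma_add_sub_pos hd hy))

lemma log_Gamma_add_sub_mem_Icc {d y : ℝ} (hd : 0 < d) (hy : 0 < y) :
    (log (Gamma (y + d)) - log (Gamma y)) / d ∈ Icc (digamma y) (digamma (y + d)) := by
  obtain ⟨c, hc, h⟩ := exists_hasDerivAt_eq_slope (fun x => log (Gamma x)) digamma
    (by linarith : y < y + d)
    (fun x hx => (hasDerivAt_log_Gamma (hy.trans_le hx.1)).continuousAt.continuousWithinAt)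
    fun x hx => hasDerivAt_log_Gamma (hy.trans hx.1)
  rw [add_sub_cancel_left] at h
  rw [← h]
  have hc₀ : 0 < c := hy.trans hc.1
  exact ⟨monotoneOn_digamma hy hc₀ hc.1.le,
    monotoneOn_digamma hc₀ (hc₀.trans hc.2) hc.2.le⟩

lemma tendsto_slope_log_Gamma_sub_log {d : ℝ} (hd : 0 < d) :
    Tendsto (fun y => (log (Gamma (y + d)) - log (Gamma y)) / d - log y) atTop (𝓝 0) := by
  have hbound : ∀ᶠ y : ℝ in atTop,
      |(log (Gamma (y + d)) - log (Gamma y)) / d - log y| ≤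
        (digamma (y + d) - digamma y) + (digamma (y + 1) - digamma y) := by
    filter_upwards [eventually_gt_atTop 0] with y hy
    have h₁ := log_Gamma_add_sub_mem_Icc hd hy
    have h₂ := log_Gamma_add_sub_mem_Icc one_pos hy
    rw [log_Gamma_add_one hy, add_sub_cancel_right, div_one] at h₂
    rw [abs_le]
    constructor <;> linarith [h₁.1, h₁.2, h₂.1, h₂.2]
  refine squeeze_zero_norm' hbound ?_
  simpa using (tendsto_digamma_add_sub d hd).add (tendsto_digamma_add_sub 1 one_pos)

lemma tendsto_digamma_gap_mul {d : ℝ} (hd : 0 < d) :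
    Tendsto (fun y => (digamma (y + d) - digamma y) / d * y) atTop (𝓝 1) := by
  have h₁ : Tendsto (fun y : ℝ => 1 - d / (y + d)) atTop (𝓝 1) := by
    simpa using tendsto_const_nhds.sub ((tendsto_const_nhds (x := d)).div_atTop
      (tendsto_atTop_add_const_right atTop d tendsto_id))
  have h₂ : Tendsto (fun y : ℝ => 1 + 1 / (y - 1)) atTop (𝓝 1) := by
    simpa [sub_eq_add_neg] using tendsto_const_nhds.add
      ((tendsto_const_nhds (x := (1 : ℝ))).div_atTop
      (tendsto_atTop_add_const_right atTop (-1) tendsto_id))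
  refine tendsto_of_tendsto_of_tendsto_of_le_of_le' h₁ h₂ ?_ ?_
  · filter_upwards [eventually_gt_atTop 0] with y hy
    have h := div_add_lt_digamma_add_sub hd hy
    calc 1 - d / (y + d) = d / (y + d) / d * y := by
          field_simp
          ring
      _ ≤ _ := by gcongr
  · filter_upwards [eventually_gt_atTop 1] with y hy
    have hy₁ : 0 < y - 1 := by linarith
    have h := digamma_add_sub_lt_div hd hy₁
    rw [sub_add_cancel] at h
    calc (digamma (y + d) - digamma y) / d * y ≤ d / (y - 1) / d * y := by gcongr
      _ = 1 + 1 / (y - 1) := by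
          field_simp
          ring

lemma tendsto_logPhi {d : ℝ} (hd : 0 < d) : Tendsto (logPhi d) atTop (𝓝 0) := by
  have h := ((tendsto_digamma_gap_mul hd).log one_ne_zero).add (tendsto_slope_log_Gamma_sub_log hd)
  rw [log_one, add_zero] at h
  refine h.congr' ?_
  filter_upwards [eventually_gt_atTop 0] with y hy
  rw [log_mul (div_pos (digamma_add_sub_pos hd hy) hd).ne' hy.ne', logPhi]
  ring

lemma one_sub_mul_logPhi_neg {d y : ℝ} (hd : 0 < d) (hd₁ : d ≠ 1) (hy : 0 < y) :
    (1 - d) * logPhi d y < 0 := by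
  rw [← neg_pos]
  refine pos_of_add_one_lt_of_tendsto (f := fun y => -((1 - d) * logPhi d y))
    (fun y hy => neg_lt_neg ?_) (fun y _ => ?_) hy
  · exact strictMonoOn_one_sub_mul_logPhi hd hd₁ hy (by simp; linarith) (by linarith)
  · simpa using (((tendsto_logPhi hd).comp (tendsto_add_natCast y)).const_mul (1 - d)).neg

lemma digamma_slope_mul_rpow_eq_exp {s t x : ℝ} (hst : t < s) (hx : 0 < x + t) :
    (digamma (x + s) - digamma (x + t)) / (s - t) *
      (Gamma (x + s) / Gamma (x + t)) ^ (1 / (s - t)) = exp (logPhi (s - t) (x + t)) := by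
  have hd : 0 < s - t := sub_pos.2 hst
  have hA := digamma_add_sub_pos hd hx
  have e : x + t + (s - t) = x + s := by ring
  rw [e] at hA
  have hs := Gamma_pos_of_pos (by linarith : 0 < x + s)
  have ht := Gamma_pos_of_pos hx
  rw [logPhi, e, exp_add, exp_log (div_pos hA hd), rpow_def_of_pos (div_pos hs ht),
    log_div hs.ne' ht.ne', mul_one_div]

lemma phi_eq_exp_logPhi {s t x : ℝ} (hst : s ≠ t) (hx : x ∈ Ioi (-(min s t))) :
    (digamma (x + s) - digamma (x + t)) / (s - t) *
      (Gamma (x + s) / Gamma (x + t)) ^ (1 / (s - t)) =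
      exp (logPhi |t - s| (x + min s t)) := by
  rw [mem_Ioi, neg_lt_iff_pos_add] at hx
  rcases hst.lt_or_gt with h | h
  · rw [min_eq_left h.le] at hx ⊢
    rw [abs_of_pos (sub_pos.2 h), ← digamma_slope_mul_rpow_eq_exp h hx]
    congr 1
    · rw [← neg_sub, ← neg_sub t s, neg_div_neg_eq]
    · rw [← inv_div, inv_rpow, ← rpow_neg, ← neg_sub, one_div_neg_eq_neg_one_div, neg_neg]
      all_goals
        have := Gamma_pos_of_pos hx
        have := Gamma_pos_of_pos (by linarith : 0 < x + t)
        positivity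
  · rw [min_eq_right h.le] at hx ⊢
    rw [abs_sub_comm, abs_of_pos (sub_pos.2 h), digamma_slope_mul_rpow_eq_exp h hx]

lemma slope_digamma_pos {s t x : ℝ} (hst : s ≠ t) (hx : x ∈ Ioi (-(min s t))) :
    0 < (digamma (x + s) - digamma (x + t)) / (s - t) := by
  have h := exp_pos (logPhi |t - s| (x + min s t))
  rw [← phi_eq_exp_logPhi hst hx] at h
  rw [mem_Ioi, neg_lt_iff_pos_add] at hx
  have hs := Gamma_pos_of_pos (hx.trans_le (add_le_add_right (min_le_left s t) x))
  have ht := Gamma_pos_of_pos (hx.trans_le (add_le_add_right (min_le_right s t) x))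
  exact (pos_iff_pos_of_mul_pos h).2 (rpow_pos_of_pos (div_pos hs ht) _)

end

/-- For `s ≠ t`, the function
`Φ_{s,t}(x) = [(ψ(x+s) − ψ(x+t))/(s − t)]·[Γ(x+s)/Γ(x+t)]^{1/(s−t)}`
is increasing on `(−min{s,t}, ∞)` if `|t − s| < 1` and decreasing if `|t − s| > 1`;
consequently, for `0 < |t − s| < 1`,
`[Γ(x+t)/Γ(x+s)]^{1/(t−s)} < (t − s)/(ψ(x+t) − ψ(x+s))` on `(−min{s,t}, ∞)`,
and the reversed inequality holds when `|t − s| > 1`. -/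
theorem phi_monotonicity_and_gamma_ratio_ineq (s t : ℝ) (hst : s ≠ t) :
    (|t - s| < 1 →
      StrictMonoOn
        (fun x : ℝ =>
          (digamma (x + s) - digamma (x + t)) / (s - t) *
            (Real.Gamma (x + s) / Real.Gamma (x + t)) ^ (1 / (s - t)))
        (Set.Ioi (-(min s t)))) ∧
    (|t - s| > 1 →
      StrictAntiOn
        (fun x : ℝ =>
          (digamma (x + s) - digamma (x + t)) / (s - t) *
            (Real.Gamma (x + s) / Real.Gamma (x + t)) ^ (1 / (s - t)))
        (Set.Ioi (-(min s t)))) ∧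
    (0 < |t - s| ∧ |t - s| < 1 →
      ∀ x ∈ Set.Ioi (-(min s t)),
        (Real.Gamma (x + t) / Real.Gamma (x + s)) ^ (1 / (t - s)) <
          (t - s) / (digamma (x + t) - digamma (x + s))) ∧
    (|t - s| > 1 →
      ∀ x ∈ Set.Ioi (-(min s t)),
        (t - s) / (digamma (x + t) - digamma (x + s)) <
          (Real.Gamma (x + t) / Real.Gamma (x + s)) ^ (1 / (t - s))) := by
  have hd : 0 < |t - s| := abs_pos.2 (sub_ne_zero.2 hst.symm)
  have hpos {x : ℝ} (hx : x ∈ Set.Ioi (-(min s t))) : x + min s t ∈ Set.Ioi (0 : ℝ) :=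
    Set.mem_Ioi.2 (neg_lt_iff_pos_add.1 (Set.mem_Ioi.1 hx))
  have hmono (hd₁ : |t - s| ≠ 1) {a b : ℝ} (ha : a ∈ Set.Ioi (-(min s t)))
      (hb : b ∈ Set.Ioi (-(min s t))) (hab : a < b) :=
    strictMonoOn_one_sub_mul_logPhi hd hd₁ (hpos ha) (hpos hb)
      ((add_lt_add_iff_right (min s t)).2 hab)
  have hneg (hd₁ : |t - s| ≠ 1) {x : ℝ} (hx : x ∈ Set.Ioi (-(min s t))) :=
    one_sub_mul_logPhi_neg hd hd₁ (hpos hx)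
  have hphi {x : ℝ} (hx : x ∈ Set.Ioi (-(min s t))) :
      0 < (digamma (x + t) - digamma (x + s)) / (t - s) ∧
      (digamma (x + t) - digamma (x + s)) / (t - s) *
        (Real.Gamma (x + t) / Real.Gamma (x + s)) ^ (1 / (t - s)) =
        Real.exp (logPhi |t - s| (x + min s t)) := by
    rw [min_comm] at hx
    rw [min_comm, abs_sub_comm]
    exact ⟨slope_digamma_pos hst.symm hx, phi_eq_exp_logPhi hst.symm hx⟩
  refine ⟨fun h a ha b hb hab => ?_, fun h a ha b hb hab => ?_, fun h x hx => ?_, fun h x hx => ?_⟩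
  · simp only [phi_eq_exp_logPhi hst ha, phi_eq_exp_logPhi hst hb]
    exact Real.exp_lt_exp.2 (lt_of_mul_lt_mul_left (hmono h.ne ha hb hab) (by linarith))
  · simp only [phi_eq_exp_logPhi hst ha, phi_eq_exp_logPhi hst hb]
    exact Real.exp_lt_exp.2 (lt_of_mul_lt_mul_of_nonpos_left (hmono h.ne' ha hb hab) (by linarith))
  · obtain ⟨h₀, h₁⟩ := hphi hx
    rw [← one_div_div (digamma _ - _), lt_div_iff₀' h₀, h₁, Real.exp_lt_one_iff]
    exact neg_of_mul_neg_right (hneg h.2.ne hx) (by linarith)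
  · obtain ⟨h₀, h₁⟩ := hphi hx
    rw [← one_div_div (digamma _ - _), div_lt_iff₀' h₀, h₁, Real.one_lt_exp_iff]
    exact pos_of_mul_neg_right (hneg h.ne' hx) (by linarith)
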